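/- Let f : X → Y be a finite surjective morphism of schemes over ℂ with X affine. Then Y is affine. -/

import Mathlib

open AlgebraicGeometry CategoryTheory

universe u



lemma chev_charpoly {R S K L : Type*} [CommRing R] [CommRing S] [Field K] [Field L] [Algebra R S]
    [Algebra R K] [Algebra S L] [Algebra K L] [Algebra R L] [IsScalarTower R S L]
    [IsScalarTower R K L] [IsDomain R] [IsFractionRing R K] [Module.Finite R S]
    [FiniteDimensional K L] :
    ∃ a : R, a ≠ 0 ∧ ∀ (r : R) (s : S),
      (Algebra.lmul K L (algebraMap R L r + algebraMap R L a * algebraMap S L s)).charpoly ∈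
        Polynomial.lifts (algebraMap R K) := by
  classical
  obtain ⟨T, hT⟩ := Module.Finite.fg_top (R := R) (M := S)
  let e := Module.finBasis K L
  let n := Module.finrank K L
  obtain ⟨a, ha⟩ := IsLocalization.exist_integer_multiples (nonZeroDivisors R)
    (Finset.univ : Finset (T × Fin n × Fin n))
    (fun p => (Algebra.leftMulMatrix e (algebraMap S L p.1.1) p.2.1 p.2.2 : K))
  refine ⟨a, nonZeroDivisors.coe_ne_zero a, fun r s => ?_⟩
  have key : ∀ s : S, Algebra.leftMulMatrix e (algebraMap R L a * algebraMap S L s) ∈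
      (algebraMap R K).mapMatrix.range := by
    intro s
    have hs : s ∈ Submodule.span R (T : Set S) := by rw [hT]; trivial
    induction hs using Submodule.span_induction with
    | mem x hx =>
      choose! M hM using fun (i j : Fin n) => ha ⟨⟨x, hx⟩, i, j⟩ (Finset.mem_univ _)
      refine ⟨Matrix.of M, ?_⟩
      ext i j
      have h1 : algebraMap R L a * algebraMap S L x = (algebraMap R K a) • algebraMap S L x := by
        rw [Algebra.smul_def, ← IsScalarTower.algebraMap_apply]
      rw [h1, map_smul]
      simpa [Algebra.smul_def] using hM i j
    | zero => simp
    | add x y _ _ hx hy => rw [map_add, mul_add, map_add]; exact add_mem hx hy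
    | smul c x _ hx =>
      obtain ⟨M, hM⟩ := hx
      refine ⟨c • M, ?_⟩
      have h1 : algebraMap R L a * algebraMap S L (c • x) =
          (algebraMap R K c) • (algebraMap R L a * algebraMap S L x) := by
        rw [Algebra.smul_def, Algebra.smul_def, map_mul, ← IsScalarTower.algebraMap_apply,
          ← IsScalarTower.algebraMap_apply]; ring
      rw [h1, map_smul (Algebra.leftMulMatrix e), ← hM]
      ext i j
      simp only [RingHom.mapMatrix_apply, Matrix.map_apply, Matrix.smul_apply, smul_eq_mul, map_mul]
  obtain ⟨M, hM⟩ := key s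
  have h2 : Algebra.leftMulMatrix e (algebraMap R L r + algebraMap R L a * algebraMap S L s) =
      (algebraMap R K).mapMatrix (algebraMap R (Matrix (Fin n) (Fin n) R) r + M) := by
    rw [map_add, map_add, hM, IsScalarTower.algebraMap_apply R K L, AlgHom.commutes]
    congr 1
    ext i j
    simp only [Matrix.algebraMap_matrix_apply, RingHom.mapMatrix_apply, Matrix.map_apply]
    split_ifs <;> simp
  rw [← LinearMap.charpoly_toMatrix _ e]
  change (Algebra.leftMulMatrix e _).charpoly ∈ _
  rw [h2, RingHom.mapMatrix_apply, Matrix.charpoly_map]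
  exact ⟨_, rfl⟩

lemma chev_norm {R S K L : Type*} [CommRing R] [CommRing S] [Field K] [Field L] [Algebra R S]
    [Algebra R K] [Algebra S L] [Algebra K L] [Algebra R L] [IsScalarTower R S L]
    [IsScalarTower R K L] [IsDomain R] [IsFractionRing R K] [Module.Finite R S]
    [FiniteDimensional K L] (b : S) (g : R)
    (hg : algebraMap R K g = (Algebra.lmul K L (algebraMap S L b)).charpoly.coeff 0)
    (p : Ideal R) [p.IsPrime] (hp : g ∈ p) :
    ∃ q : Ideal S, q.IsPrime ∧ q.comap (algebraMap R S) = p ∧ b ∈ q := by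
  have h0 : (Ideal.span {b}).comap (algebraMap R S) ≤ p := by
    intro r hr
    rw [Ideal.mem_comap, Ideal.mem_span_singleton] at hr
    obtain ⟨s, hs⟩ := hr
    have hs' : algebraMap K L (algebraMap R K r) = algebraMap S L b * algebraMap S L s := by
      rw [← IsScalarTower.algebraMap_apply, IsScalarTower.algebraMap_apply R S L, hs, map_mul]
    have h1 := congrArg (Algebra.norm K) hs'
    rw [Algebra.norm_algebraMap, map_mul, Algebra.norm_apply K (algebraMap S L b),
      LinearMap.det_eq_sign_charpoly_coeff] at h1
    change _ = _ * (Algebra.lmul K L (algebraMap S L b)).charpoly.coeff 0 * _ at h1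
    rw [← hg] at h1
    have hn : IsIntegral R (Algebra.norm K (algebraMap S L s)) :=
      Algebra.isIntegral_norm K ((Algebra.IsIntegral.isIntegral (R := R) s).algebraMap)
    obtain ⟨Q, hQp, hQ⟩ := Ideal.exists_ideal_over_prime_of_isIntegral_of_isDomain
      (S := integralClosure R K) p (by
        rw [(RingHom.injective_iff_ker_eq_bot _).1]
        · exact bot_le
        · intro x y hxy
          exact IsFractionRing.injective R K (congrArg Subtype.val hxy))
    have h2 : algebraMap R (integralClosure R K) (r ^ Module.finrank K L) =
        algebraMap R (integralClosure R K) g *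
          ((-1) ^ Module.finrank K L * ⟨_, hn⟩) := by
      apply Subtype.ext
      simp only [map_pow]
      refine h1.trans ?_
      change _ = algebraMap R K g * ((-1) ^ Module.finrank K L * (Algebra.norm K) ((algebraMap S L) s))
      ring
    have h3 : r ^ Module.finrank K L ∈ p := by
      have : algebraMap R (integralClosure R K) g ∈ Q := by rw [← Ideal.mem_comap]; rw [hQ]; exact hp
      rw [← hQ, Ideal.mem_comap, h2]
      exact Ideal.mul_mem_right _ _ this
    exact Ideal.IsPrime.mem_of_pow_mem ‹_› _ h3
  obtain ⟨Q, hQ, hQp, hQe⟩ := Ideal.exists_ideal_over_prime_of_isIntegral p _ h0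
  exact ⟨Q, hQp, hQe, hQ (Ideal.mem_span_singleton_self b)⟩

namespace Chev
variable {X Y : Scheme.{u}}

/-- restriction of sections -/
def rs {U V : X.Opens} (h : V ≤ U) : Γ(X, U) →+* Γ(X, V) := (X.presheaf.map (homOfLE h).op).hom

/-- pullback of sections -/
def pb (f : X ⟶ Y) (U : Y.Opens) : Γ(Y, U) →+* Γ(X, f ⁻¹ᵁ U) := (f.app U).hom

lemma rs_rs {U V W : X.Opens} (h : V ≤ U) (h' : W ≤ V) (x : Γ(X, U)) :
    rs h' (rs h x) = rs (h'.trans h) x := by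
  simp only [rs, ← ConcreteCategory.comp_apply, ← Functor.map_comp]
  rfl

lemma rs_refl {U : X.Opens} (h : U ≤ U) (x : Γ(X, U)) : rs h x = x := by
  change (X.presheaf.map (𝟙 _)) x = x
  simp

lemma pre_mono (f : X ⟶ Y) {U V : Y.Opens} (h : V ≤ U) : f ⁻¹ᵁ V ≤ f ⁻¹ᵁ U := fun _ hx => h hx

lemma pb_rs (f : X ⟶ Y) {U V : Y.Opens} (h : V ≤ U) (h' : f ⁻¹ᵁ V ≤ f ⁻¹ᵁ U) (x : Γ(Y, U)) :
    pb f V (rs h x) = rs h' (pb f U x) := by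
  have := ConcreteCategory.congr_hom (f.naturality (homOfLE h).op) x
  exact this

lemma glue {ι : Type*} (U : ι → X.Opens) (hU : ∀ x : X, ∃ i, x ∈ U i) (s : ∀ i, Γ(X, U i))
    (h : ∀ i j, rs (inf_le_left : U i ⊓ U j ≤ U i) (s i) = rs inf_le_right (s j)) :
    ∃ t : Γ(X, ⊤), ∀ i, rs le_top t = s i := by
  obtain ⟨t, ht, -⟩ := X.sheaf.existsUnique_gluing' U ⊤ (fun i => homOfLE le_top)
    (fun x _ => by simpa using hU x) s (fun i j => h i j)
  exact ⟨t, ht⟩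

lemma loc_eq {ι : Type*} {V : X.Opens} (U : ι → X.Opens) (hV : ∀ i, U i ≤ V)
    (hU : ∀ x ∈ V, ∃ i, x ∈ U i) (s t : Γ(X, V))
    (h : ∀ i, rs (hV i) s = rs (hV i) t) : s = t :=
  X.sheaf.eq_of_locally_eq' U V (fun i => homOfLE (hV i))
    (fun x hx => by simpa using hU x hx) s t h

lemma basicOpen_rs {U V : X.Opens} (h : V ≤ U) (x : Γ(X, U)) :
    X.basicOpen (rs h x) = V ⊓ X.basicOpen x := X.basicOpen_res x (homOfLE h).op

lemma basicOpen_pb (f : X ⟶ Y) {U : Y.Opens} (x : Γ(Y, U)) :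
    X.basicOpen (pb f U x) = f ⁻¹ᵁ Y.basicOpen x := (Scheme.preimage_basicOpen f x).symm

lemma loc0 {U V : X.Opens} (hU : IsCompact (U : Set X)) (h : V ≤ U) (f x : Γ(X, U))
    (hV : V = X.basicOpen f) (hx : rs h x = 0) : ∃ n, f ^ n * x = 0 := by
  subst hV
  exact exists_pow_mul_eq_zero_of_res_basicOpen_eq_zero_of_isCompact X hU x f hx

lemma loc1 {U V : X.Opens} (hU : IsCompact (U : Set X)) (hU' : IsQuasiSeparated (U : Set X))
    (h : V ≤ U) (f : Γ(X, U)) (x : Γ(X, V)) (hV : V = X.basicOpen f) :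
    ∃ n y, rs h y = rs h f ^ n * x := by
  subst hV
  exact exists_eq_pow_mul_of_isCompact_of_isQuasiSeparated X U hU hU' f x

lemma ideal_top [IsAffine X] (I : Ideal Γ(X, ⊤)) (h : ∀ x : X, ∃ a ∈ I, x ∈ X.basicOpen a) :
    I = ⊤ := by
  rw [← Ideal.span_eq I, ← (isAffineOpen_top X).self_le_iSup_basicOpen_iff]
  intro x _
  obtain ⟨a, ha, hx⟩ := h x
  exact TopologicalSpace.Opens.mem_iSup.2 ⟨⟨a, ha⟩, hx⟩

lemma exists_basicOpen [IsAffine X] (U : X.Opens) (x : X) (hx : x ∈ U) :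
    ∃ a : Γ(X, ⊤), x ∈ X.basicOpen a ∧ X.basicOpen a ≤ U := by
  obtain ⟨a, h1, h2⟩ := (isAffineOpen_top X).exists_basicOpen_le ⟨x, hx⟩ trivial
  exact ⟨a, h2, h1⟩

/-- pullback of global sections -/
def gpb (f : X ⟶ Y) : Γ(Y, ⊤) →+* Γ(X, ⊤) := f.appTop.hom

lemma rs_gpb (f : X ⟶ Y) {U : Y.Opens} (x : Γ(Y, ⊤)) :
    rs (le_top : f ⁻¹ᵁ U ≤ ⊤) (gpb f x) = pb f U (rs le_top x) :=
  (pb_rs f le_top (pre_mono f le_top) x).symm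

lemma basicOpen_gpb (f : X ⟶ Y) (x : Γ(Y, ⊤)) :
    X.basicOpen (gpb f x) = f ⁻¹ᵁ Y.basicOpen x := (Scheme.preimage_basicOpen f x).symm

end Chev

namespace Chev
variable {X Y Z : Scheme.{u}}

/-- `x` lifts the global function `a`. -/
def Lf (i : Z ⟶ Y) {U : Y.Opens} (x : Γ(Y, U)) (a : Γ(Z, ⊤)) : Prop :=
  pb i U x = rs le_top a

section
variable {i : Z ⟶ Y} {U V : Y.Opens} {x y : Γ(Y, U)} {a b : Γ(Z, ⊤)}
lemma Lf.add (hx : Lf i x a) (hy : Lf i y b) : Lf i (x + y) (a + b) := by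
  simp only [Lf, map_add] at *; rw [hx, hy]
lemma Lf.sub (hx : Lf i x a) (hy : Lf i y b) : Lf i (x - y) (a - b) := by
  simp only [Lf, map_sub] at *; rw [hx, hy]
lemma Lf.mul (hx : Lf i x a) (hy : Lf i y b) : Lf i (x * y) (a * b) := by
  simp only [Lf, map_mul] at *; rw [hx, hy]
lemma Lf.pow (hx : Lf i x a) (n : ℕ) : Lf i (x ^ n) (a ^ n) := by
  simp only [Lf, map_pow] at *; rw [hx]
lemma Lf.rs (hx : Lf i x a) (h : V ≤ U) : Lf i (rs h x) a := by
  simp only [Lf] at *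
  rw [pb_rs i h (pre_mono i h), hx, rs_rs]
lemma Lf.exists [IsClosedImmersion i] (hU : IsAffineOpen U) (a : Γ(Z, ⊤)) :
    ∃ x : Γ(Y, U), Lf i x a := i.app_surjective U hU _
lemma Lf.basicOpen (hs : Function.Surjective i) (hx : Lf i x a) (hV : i ⁻¹ᵁ V = Z.basicOpen a) :
    Y.basicOpen x = U ⊓ V := by
  have h1 : i ⁻¹ᵁ (Y.basicOpen x) = i ⁻¹ᵁ (U ⊓ V) := by
    rw [← basicOpen_pb, hx, basicOpen_rs, ← hV]; rfl
  ext y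
  obtain ⟨z, rfl⟩ := hs y
  exact iff_of_eq (congrArg (fun V => z ∈ V) h1)
end

/-- square zero kernel -/
def SqZ (i : Z ⟶ Y) : Prop := ∀ (U : Y.Opens) (x y : Γ(Y, U)), pb i U x = 0 → pb i U y = 0 → x * y = 0

lemma SqZ.eq {i : Z ⟶ Y} (h : SqZ i) {U : Y.Opens} {x y z : Γ(Y, U)} {a : Γ(Z, ⊤)}
    (hx : Lf i x a) (hy : Lf i y a) (hz : Lf i z 0) : x * z = y * z := by
  rw [← sub_eq_zero, ← sub_mul]
  apply h
  · rw [map_sub, hx, hy, sub_self]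
  · rw [hz, map_zero]

/-- the annihilator condition -/
def Good {ι : Type*} (i : Z ⟶ Y) (U : ι → Y.Opens) (t : ∀ k, Γ(Y, U k)) (a : Γ(Z, ⊤)) : Prop :=
  ∃ x : ∀ k, Γ(Y, U k), (∀ k, Lf i (x k) 0) ∧ ∀ k m (b : Γ(Y, U k ⊓ U m)), Lf i b a →
    rs inf_le_left (x k) - rs inf_le_right (x m) =
      b * (rs inf_le_left (t k) - rs inf_le_right (t m))

lemma good_ideal {ι : Type*} {i : Z ⟶ Y} [IsClosedImmersion i] (hsq : SqZ i) {U : ι → Y.Opens}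
    (hU : ∀ k, IsAffineOpen (U k))
    {t : ∀ k, Γ(Y, U k)} {h : Γ(Z, ⊤)} (ht : ∀ k, Lf i (t k) h) :
    ∃ J : Ideal Γ(Z, ⊤), ∀ a, a ∈ J ↔ Good i U t a := by
  have hc : ∀ k m, Lf i (rs (inf_le_left : U k ⊓ U m ≤ U k) (t k) - rs inf_le_right (t m)) 0 := by
    intro k m
    rw [← sub_self h]
    exact ((ht k).rs _).sub ((ht m).rs _)
  refine ⟨⟨⟨⟨{a | Good i U t a}, ?_⟩, ?_⟩, ?_⟩, fun a => Iff.rfl⟩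
  · rintro a b ⟨x, hx, hx'⟩ ⟨y, hy, hy'⟩
    refine ⟨fun k => x k + y k, fun k => by simpa using (hx k).add (hy k), fun k m d hd => ?_⟩
    obtain ⟨a', ha'⟩ := Lf.exists (i := i) (hU k) a
    obtain ⟨b', hb'⟩ := Lf.exists (i := i) (hU k) b
    have ha := ha'.rs (V := U k ⊓ U m) inf_le_left
    have hb := hb'.rs (V := U k ⊓ U m) inf_le_left
    rw [hsq.eq hd (ha.add hb) (hc k m), add_mul, ← hx' k m _ ha, ← hy' k m _ hb]
    simp only [map_add]; ring
  · refine ⟨fun _ => 0, fun k => by simp [Lf], fun k m d hd => ?_⟩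
    rw [hsq.eq hd (y := 0) (by simp [Lf]) (hc k m)]
    simp
  · rintro c a ⟨x, hx, hx'⟩
    choose c' hc' using fun k => Lf.exists (i := i) (hU k) c
    obtain h1 := fun k m => (hc' k).rs (V := U k ⊓ U m) inf_le_left
    obtain h2 := fun k m => (hc' m).rs (V := U k ⊓ U m) inf_le_right
    refine ⟨fun k => c' k * x k, fun k => by simpa using (hc' k).mul (hx k), fun k m d hd => ?_⟩
    obtain ⟨a', ha'⟩ := Lf.exists (i := i) (hU k) a
    have ha := ha'.rs (V := U k ⊓ U m) inf_le_left
    rw [hsq.eq hd ((h1 k m).mul ha) (hc k m), mul_assoc, ← hx' k m _ ha]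
    simp only [map_mul, mul_sub]
    rw [hsq.eq (h1 k m) (h2 k m) ((hx m).rs _)]

lemma good_pow {ι : Type*} [Finite ι] {i : Z ⟶ Y} [IsClosedImmersion i] (hsq : SqZ i)
    [QuasiSeparatedSpace Y] [IsAffine Z]
    (hs : Function.Surjective i) {U : ι → Y.Opens}
    (hU : ∀ k, IsAffineOpen (U k))
    {t : ∀ k, Γ(Y, U k)} {h : Γ(Z, ⊤)} (ht : ∀ k, Lf i (t k) h)
    (l : ι) (a : Γ(Z, ⊤)) (ha : i ⁻¹ᵁ U l = Z.basicOpen a) : ∃ n, Good i U t (a ^ n) := by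
  have hc : ∀ k m, Lf i (rs (inf_le_left : U k ⊓ U m ≤ U k) (t k) - rs inf_le_right (t m)) 0 := by
    intro k m
    rw [← sub_self h]
    exact ((ht k).rs _).sub ((ht m).rs _)
  choose a' ha' using fun k => Lf.exists (i := i) (hU k) a
  have hb : ∀ k, U k ⊓ U l = Y.basicOpen (a' k) := fun k => ((ha' k).basicOpen hs ha).symm
  -- step one
  have s1 : ∀ k, ∃ n, ∃ d : Γ(Y, U k), Lf i d 0 ∧ rs (inf_le_left : U k ⊓ U l ≤ U k) d =
      rs inf_le_left (a' k) ^ n * (rs inf_le_left (t k) - rs inf_le_right (t l)) := by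
    intro k
    obtain ⟨n, y, hy⟩ := loc1 (hU k).isCompact (hU k).isQuasiSeparated inf_le_left (a' k)
      (rs (inf_le_left : U k ⊓ U l ≤ U k) (t k) - rs inf_le_right (t l)) (hb k)
    have h1 : Lf i (rs (inf_le_left : U k ⊓ U l ≤ U k) y) 0 := by
      rw [hy]; simpa using (((ha' k).rs inf_le_left).pow n).mul (hc k l)
    have hqc : IsCompact ((i ⁻¹ᵁ U k : Z.Opens) : Set Z) := ((hU k).preimage i).isCompact
    obtain ⟨p, hp⟩ := loc0 hqc (V := i ⁻¹ᵁ (U k ⊓ U l)) (pre_mono i inf_le_left) (pb i _ (a' k)) (pb i _ y)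
      (by rw [hb, basicOpen_pb])
      (by rw [← pb_rs i inf_le_left]; rw [h1, map_zero])
    refine ⟨p + n, a' k ^ p * y, ?_, ?_⟩
    · simp only [Lf, map_mul, map_pow, map_zero, hp]
    · rw [map_mul, hy, map_pow, pow_add, mul_assoc]
  choose n d hd hd' using s1
  obtain ⟨N, hN⟩ : ∃ N, ∀ k, n k ≤ N := by
    obtain ⟨N, hN⟩ := (Set.finite_range n).bddAbove
    exact ⟨N, fun k => hN ⟨k, rfl⟩⟩
  let e := fun k => a' k ^ (N - n k) * d k
  have he : ∀ k, Lf i (e k) 0 := fun k => by simpa using ((ha' k).pow _).mul (hd k)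
  have he' : ∀ k, rs (inf_le_left : U k ⊓ U l ≤ U k) (e k) =
      rs inf_le_left (a' k) ^ N * (rs inf_le_left (t k) - rs inf_le_right (t l)) := by
    intro k
    rw [map_mul, hd', map_pow, ← mul_assoc, ← pow_add, Nat.sub_add_cancel (hN k)]
  clear_value e
  have s2 : ∀ q : ι × ι, ∃ p, ∀ p' ≥ p, rs (inf_le_left : U q.1 ⊓ U q.2 ≤ U q.1) (a' q.1) ^ p' *
      (rs inf_le_left (e q.1) - rs inf_le_right (e q.2) - rs inf_le_left (a' q.1) ^ N *
        (rs inf_le_left (t q.1) - rs inf_le_right (t q.2))) = 0 := by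
    rintro ⟨k, m⟩
    have hqc : IsCompact ((U k ⊓ U m : Y.Opens) : Set Y) :=
      (hU k).isCompact.inter_of_isOpen (hU m).isCompact (U k).2 (U m).2
    obtain ⟨p, hp⟩ := loc0 hqc (V := U k ⊓ U m ⊓ U l) inf_le_left
      (rs (inf_le_left : U k ⊓ U m ≤ U k) (a' k))
      (rs inf_le_left (e k) - rs inf_le_right (e m) - rs inf_le_left (a' k) ^ N *
        (rs inf_le_left (t k) - rs inf_le_right (t m)))
      (by rw [basicOpen_rs, ← hb]; ext x; simp; tauto) (by
        have e1 := congrArg (rs (show U k ⊓ U m ⊓ U l ≤ U k ⊓ U l from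
          fun _ h => ⟨h.1.1, h.2⟩)) (he' k)
        have e2 := congrArg (rs (show U k ⊓ U m ⊓ U l ≤ U m ⊓ U l from
          fun _ h => ⟨h.1.2, h.2⟩)) (he' m)
        have h3 : Lf i (rs (show U k ⊓ U m ⊓ U l ≤ U m from fun _ h => h.1.2) (t m) -
            rs (show U k ⊓ U m ⊓ U l ≤ U l from fun _ h => h.2) (t l)) 0 := by
          rw [← sub_self h]
          exact ((ht _).rs _).sub ((ht _).rs _)
        simp only [map_mul, map_sub, map_pow, rs_rs] at e1 e2 ⊢
        rw [e1, e2, hsq.eq (((ha' m).rs _).pow N) (((ha' k).rs (inf_le_left.trans inf_le_left)).pow N) h3]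
        ring)
    refine ⟨p, fun p' hp' => ?_⟩
    rw [← Nat.sub_add_cancel hp', pow_add, mul_assoc, hp, mul_zero]
  choose P hP using s2
  obtain ⟨p, hp⟩ : ∃ N, ∀ k, P k ≤ N := by
    obtain ⟨N, hN⟩ := (Set.finite_range P).bddAbove
    exact ⟨N, fun k => hN ⟨k, rfl⟩⟩
  refine ⟨p + N, fun k => a' k ^ p * e k, fun k => by simpa using ((ha' k).pow _).mul (he k),
    fun k m b hb => ?_⟩
  have := hP (k, m) p (hp _)
  dsimp only at this ⊢
  rw [hsq.eq hb (((ha' k).rs inf_le_left).pow (p + N)) (hc k m), map_mul, map_mul, map_pow, map_pow,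
    hsq.eq (((ha' m).rs _).pow p) (((ha' k).rs inf_le_left).pow p) ((he m).rs _), pow_add]
  linear_combination this

end Chev

namespace Chev
variable {X Y Z : Scheme.{u}}

lemma nil_cover (i : Z ⟶ Y) [IsClosedImmersion i] (hs : Function.Surjective i) [IsAffine Z]
    (y : Y) : ∃ (a : Γ(Z, ⊤)) (V : Y.Opens), IsAffineOpen V ∧ y ∈ V ∧ i ⁻¹ᵁ V = Z.basicOpen a := by
  obtain ⟨z, rfl⟩ := hs y
  obtain ⟨_, ⟨U, hU, rfl⟩, hzU, -⟩ := Y.isBasis_affineOpens.exists_subset_of_mem_open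
    (Set.mem_univ (i z)) isOpen_univ
  have hU : IsAffineOpen U := hU
  obtain ⟨a, ha, haU⟩ := exists_basicOpen (i ⁻¹ᵁ U) z hzU
  obtain ⟨a', ha'⟩ := Lf.exists (i := i) hU a
  have h1 : i ⁻¹ᵁ (Y.basicOpen a') = Z.basicOpen a := by
    rw [← basicOpen_pb, ha', basicOpen_rs]
    exact inf_eq_right.2 haU
  refine ⟨a, Y.basicOpen a', hU.basicOpen a', ?_, h1⟩
  change z ∈ i ⁻¹ᵁ (Y.basicOpen a')
  rwa [h1]

lemma nil_lift (i : Z ⟶ Y) [IsClosedImmersion i] (hsq : SqZ i) (hs : Function.Surjective i)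
    [IsAffine Z] [CompactSpace Y] [QuasiSeparatedSpace Y] : Function.Surjective (gpb i) := by
  intro h
  choose a V hV hyV hVa using nil_cover i hs
  obtain ⟨T, hT⟩ := CompactSpace.elim_nhds_subcover (fun y => (V y : Set Y))
    (fun y => (V y).2.mem_nhds (hyV y))
  have hT' : ∀ y, ∃ k : T, y ∈ V k.1 := by
    intro y
    have : y ∈ (⊤ : Set Y) := trivial
    rw [← hT] at this
    simpa using this
  let U : T → Y.Opens := fun k => V k.1
  have hU : ∀ k, IsAffineOpen (U k) := fun k => hV _
  choose t ht using fun k => Lf.exists (i := i) (hU k) h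
  obtain ⟨J, hJ⟩ := good_ideal hsq hU ht
  have hJt : J = ⊤ := by
    rw [← Ideal.radical_eq_top]
    apply ideal_top
    intro z
    obtain ⟨k, hk⟩ := hT' (i z)
    obtain ⟨n, hn⟩ := good_pow hsq hs hU ht k (a k.1) (hVa _)
    refine ⟨a k.1, ⟨n, (hJ _).2 hn⟩, ?_⟩
    rw [← hVa]
    exact hk
  obtain ⟨x, hx, hx'⟩ := (hJ 1).1 (hJt ▸ trivial)
  obtain ⟨g, hg⟩ := glue U hT' (fun k => t k - x k) (by
    intro k m
    have := hx' k m 1 (by simp [Lf])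
    simp only [map_sub]
    linear_combination -this)
  refine ⟨g, ?_⟩
  refine loc_eq (fun k => i ⁻¹ᵁ U k) (fun _ => le_top) (fun z _ => hT' (i z)) _ _ fun k => ?_
  rw [rs_gpb, hg]
  have := (ht k).sub (hx k)
  rw [sub_zero] at this
  exact this

lemma nil2 (i : Z ⟶ Y) [IsClosedImmersion i] (hsq : SqZ i) (hs : Function.Surjective i)
    [IsAffine Z] [CompactSpace Y] [QuasiSeparatedSpace Y] : IsAffine Y := by
  have hsur := nil_lift i hsq hs
  let s : Set Γ(Y, ⊤) := {g | IsAffineOpen (Y.basicOpen g)}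
  refine isAffine_of_isAffineOpen_basicOpen s ?_ (fun _ h => h)
  have h1 : (Ideal.span s).map (gpb i) = ⊤ := by
    apply ideal_top
    intro z
    obtain ⟨a, V, hV, hzV, hVa⟩ := nil_cover i hs (i z)
    obtain ⟨g, rfl⟩ := hsur a
    have h2 : Y.basicOpen g = V := by
      have : Lf i g (gpb i g) := (rs_refl le_rfl _).symm
      rw [this.basicOpen hs hVa, top_inf_eq]
    refine ⟨_, Ideal.mem_map_of_mem _ (Ideal.subset_span (a := g) ?_), ?_⟩
    · change IsAffineOpen (Y.basicOpen g); rwa [h2]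
    · rw [← hVa]; exact hzV
  rw [Ideal.eq_top_iff_one] at h1 ⊢
  obtain ⟨g, hg, hg1⟩ := (Ideal.mem_map_iff_of_surjective _ hsur).1 h1
  have h3 : (g - 1) * (g - 1) = 0 := by
    have : pb i ⊤ (g - 1) = 0 := by
      rw [map_sub, map_one, sub_eq_zero]; exact hg1
    exact hsq _ _ _ this this
  have : (1 : Γ(Y, ⊤)) = (2 - g) * g := by linear_combination h3
  rw [this]
  exact Ideal.mul_mem_left _ _ hg

end Chev

namespace Chev
variable {X Y Z : Scheme.{u}}

lemma fin_cover (Y : Scheme.{u}) [CompactSpace Y] : ∃ (ι : Type u) (_ : Finite ι) (U : ι → Y.affineOpens),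
    ∀ y, ∃ k, y ∈ (U k).1 := by
  have : ∀ y : Y, ∃ U : Y.affineOpens, y ∈ U.1 := by
    intro y
    obtain ⟨_, ⟨U, hU, rfl⟩, hzU, -⟩ := Y.isBasis_affineOpens.exists_subset_of_mem_open
      (Set.mem_univ y) isOpen_univ
    exact ⟨⟨U, hU⟩, hzU⟩
  choose V hyV using this
  obtain ⟨T, hT⟩ := CompactSpace.elim_nhds_subcover (fun y => ((V y).1 : Set Y))
    (fun y => (V y).1.2.mem_nhds (hyV y))
  refine ⟨T, inferInstance, fun k => V k.1, fun y => ?_⟩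
  have : y ∈ (⊤ : Set Y) := trivial
  rw [← hT] at this
  simpa using this

lemma noeth (f : X ⟶ Y) [IsFinite f] [IsNoetherian Y] : IsNoetherian X :=
  { toIsLocallyNoetherian := LocallyOfFiniteType.isLocallyNoetherian f
    toCompactSpace := QuasiCompact.compactSpace_of_compactSpace f }

lemma pow_bound {ι : Type*} [Finite ι] [IsLocallyNoetherian Y] (U : ι → Y.affineOpens)
    (I : Y.IdealSheafData) (a : ∀ k, Ideal Γ(Y, U k)) (h : ∀ k, I.ideal (U k) ≤ (a k).radical) :
    ∃ n, ∀ k, (I ^ (n + 1)).ideal (U k) ≤ a k := by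
  have : ∀ k, ∃ n, I.ideal (U k) ^ n ≤ a k := fun k =>
    Ideal.exists_pow_le_of_le_radical_of_fg (h k) (by
      have := IsLocallyNoetherian.component_noetherian (U k)
      exact IsNoetherian.noetherian _)
  choose n hn using this
  obtain ⟨N, hN⟩ : ∃ N, ∀ k, n k ≤ N := by
    obtain ⟨N, hN⟩ := (Set.finite_range n).bddAbove
    exact ⟨N, fun k => hN ⟨k, rfl⟩⟩
  exact ⟨N, fun k => (Ideal.pow_le_pow_right ((hN k).trans (Nat.le_succ _))).trans (hn k)⟩

lemma support_top_nilp [IsNoetherian Y] (I : Y.IdealSheafData) (h : I.support = ⊤) :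
    ∃ n, I ^ (n + 1) = ⊥ := by
  obtain ⟨ι, _, U, hU⟩ := fin_cover Y
  obtain ⟨n, hn⟩ := pow_bound U I (fun k => ⊥) (fun k => by
    have h1 : I ≤ (⊥ : Y.IdealSheafData).radical := by
      rw [← Scheme.IdealSheafData.vanishingIdeal_support,
        ← Scheme.IdealSheafData.le_support_iff_le_vanishingIdeal, h]
      exact le_top
    exact h1 (U k))
  refine ⟨n, le_bot_iff.1 (Scheme.IdealSheafData.le_of_iSup_eq_top U ?_ hn)⟩
  refine top_le_iff.1 fun y _ => ?_
  simpa using hU y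

lemma nil_step [IsNoetherian Y] (I : Y.IdealSheafData) [IsAffine I.subscheme] :
    IsAffine (I * I).subscheme := by
  have hle : I * I ≤ I := fun U => Ideal.mul_le_right
  let j := Scheme.IdealSheafData.inclusion hle
  have hj : j ≫ (I * I).subschemeι = I.subschemeι := Scheme.IdealSheafData.inclusion_subschemeι hle
  have : IsClosedImmersion (j ≫ (I * I).subschemeι) := by rw [hj]; infer_instance
  have : IsClosedImmersion j := IsClosedImmersion.of_comp_isClosedImmersion j (I * I).subschemeι
  have : IsNoetherian (I * I).subscheme := noeth (I * I).subschemeι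
  refine nil2 j ?_ ?_
  · intro W x y hx hy
    -- local computation
    let P := {U : Y.affineOpens // (I * I).subschemeι ⁻¹ᵁ U.1 ≤ W}
    refine loc_eq (fun U : P => (I * I).subschemeι ⁻¹ᵁ U.1.1) (fun U => U.2) ?_ _ _ ?_
    · intro w hw
      obtain ⟨W', hW', hWW'⟩ := (I * I).subschemeι.isClosedEmbedding.isInducing.isOpen_iff.1 W.2
      obtain ⟨_, ⟨U, hU, rfl⟩, hzU, hUW⟩ := Y.isBasis_affineOpens.exists_subset_of_mem_open
        (show (I * I).subschemeι w ∈ W' by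
          change w ∈ (I * I).subschemeι ⁻¹' W'; rw [hWW']; exact hw) hW'
      refine ⟨⟨⟨U, hU⟩, fun z hz => ?_⟩, hzU⟩
      change z ∈ W.1
      rw [← hWW']
      exact hUW hz
    · rintro ⟨U, hUW⟩
      dsimp only
      have key : ∀ x : Γ((I * I).subscheme, W), pb j W x = 0 → ∃ x' ∈ I.ideal U,
          pb (I * I).subschemeι U.1 x' = rs hUW x := by
        intro x hx
        obtain ⟨x', hx'⟩ := (I * I).subschemeι.app_surjective U.1 U.2 (rs hUW x)
        refine ⟨x', ?_, hx'⟩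
        have h1 : pb j _ (pb (I * I).subschemeι U.1 x') = 0 := by
          have : pb (I * I).subschemeι U.1 x' = rs hUW x := hx'
          rw [this, pb_rs j hUW (pre_mono j hUW), hx, map_zero]
        rw [← I.ker_subschemeι, Scheme.Hom.ker_apply, ← hj]
        rw [RingHom.mem_ker]
        rw [Scheme.Hom.comp_app]
        exact h1
      obtain ⟨x', hx', hxx⟩ := key x hx
      obtain ⟨y', hy', hyy⟩ := key y hy
      rw [map_mul, map_zero, ← hxx, ← hyy, ← map_mul]
      have : x' * y' ∈ (I * I).ideal U := Ideal.mul_mem_mul hx' hy'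
      rw [← (I * I).ker_subschemeι, Scheme.Hom.ker_apply] at this
      exact this
  · intro y
    have h1 : (I * I).subschemeι y ∈ Set.range I.subschemeι := by
      have : (I * I).subschemeι y ∈ Set.range (I * I).subschemeι := ⟨y, rfl⟩
      rw [Scheme.IdealSheafData.range_subschemeι] at this ⊢
      simpa using this
    obtain ⟨z, hz⟩ := h1
    refine ⟨z, (I * I).subschemeι.isClosedEmbedding.injective ?_⟩
    rw [← hz, ← hj]; rfl

lemma nil_affine (i : Z ⟶ Y) [IsClosedImmersion i] (hs : Function.Surjective i) [IsNoetherian Y]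
    [IsAffine Z] : IsAffine Y := by
  let I := i.ker
  have h1 : I.support = ⊤ := by
    ext x
    change x ∈ (I.support : Set Y) ↔ _
    rw [Scheme.Hom.support_ker, hs.range_eq]
    simp
  obtain ⟨n, hn⟩ := support_top_nilp I h1
  have h2 : ∀ m : ℕ, IsAffine (I ^ (2 ^ m)).subscheme := by
    intro m
    induction m with
    | zero => 
      rw [pow_zero, pow_one]
      exact .of_isIso (inv i.toImage)
    | succ m ih => rw [pow_succ 2, mul_two, pow_add]; exact nil_step _
  have h3 : I ^ (2 ^ (n + 1)) = ⊥ := by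
    obtain ⟨k, hk⟩ := Nat.exists_eq_add_of_le (Nat.lt_two_pow_self (n := n + 1)).le
    rw [hk, pow_add, hn]; simp
  have h4 := h2 (n + 1)
  rw [h3] at h4
  exact .of_isIso (inv (Scheme.IdealSheafData.subschemeι (⊥ : Y.IdealSheafData)))

end Chev

namespace Chev
variable {X Y Z W : Scheme.{u}}

/-- The prime ideal of sections vanishing at a point. -/
noncomputable def pr {U : X.Opens} (x : X) (hx : x ∈ U) : Ideal Γ(X, U) :=
  (IsLocalRing.maximalIdeal (X.presheaf.stalk x)).comap (X.presheaf.germ U x hx).hom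

instance {U : X.Opens} (x : X) (hx : x ∈ U) : (pr x hx).IsPrime := by
  unfold pr; infer_instance

lemma pr_prime {U : X.Opens} (x : X) (hx : x ∈ U) : (pr x hx).IsPrime := inferInstance

lemma mem_pr {U : X.Opens} {x : X} {hx : x ∈ U} {b : Γ(X, U)} :
    b ∈ pr x hx ↔ x ∉ X.basicOpen b := by
  rw [X.mem_basicOpen _ x hx, pr, Ideal.mem_comap, IsLocalRing.mem_maximalIdeal, mem_nonunits_iff]

lemma exists_pr {U : X.Opens} (hU : IsAffineOpen U) (P : Ideal Γ(X, U)) [hP : P.IsPrime] :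
    ∃ (x : X) (hx : x ∈ U), pr x hx = P := by
  let p : PrimeSpectrum Γ(X, U) := ⟨P, hP⟩
  have hp : hU.fromSpec p ∈ U := by
    have : hU.fromSpec p ∈ Set.range hU.fromSpec := ⟨p, rfl⟩
    rw [hU.range_fromSpec] at this
    exact this
  refine ⟨hU.fromSpec p, hp, ?_⟩
  ext b
  rw [mem_pr]
  have : hU.fromSpec p ∈ X.basicOpen b ↔ p ∈ PrimeSpectrum.basicOpen b := by
    rw [← hU.fromSpec_preimage_basicOpen]; rfl
  rw [this, PrimeSpectrum.mem_basicOpen, not_not]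

lemma pr_inj {U : X.Opens} (hU : IsAffineOpen U) {x y : X} {hx : x ∈ U} {hy : y ∈ U}
    (h : pr x hx = pr y hy) : x = y := by
  refine (inseparable_iff_forall_isOpen.2 fun V hV => ?_).eq
  have key : ∀ x y : X, ∀ (hx : x ∈ U) (hy : y ∈ U), pr x hx = pr y hy → x ∈ V → y ∈ V := by
    intro x y hx hy h hxV
    obtain ⟨b, hb, hxb⟩ := hU.exists_basicOpen_le (V := ⟨V, hV⟩) ⟨x, hxV⟩ hx
    have : b ∉ pr x hx := by rw [mem_pr, not_not]; exact hxb
    rw [h, mem_pr, not_not] at this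
    exact hb this
  exact ⟨key _ _ hx hy h, key _ _ hy hx h.symm⟩

lemma rad [IsAffine X] (I : Ideal Γ(X, ⊤)) (b : Γ(X, ⊤))
    (h : ∀ x ∈ X.basicOpen b, ∃ a ∈ I, x ∈ X.basicOpen a) : ∃ n, b ^ (n + 1) ∈ I := by
  have : b ∈ I.radical := by
    rw [Ideal.radical_eq_sInf, Ideal.mem_sInf]
    rintro P ⟨hIP, hP⟩
    obtain ⟨x, hx, rfl⟩ := exists_pr (isAffineOpen_top X) P
    rw [mem_pr]
    intro hxb
    obtain ⟨a, ha, hxa⟩ := h x hxb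
    exact mem_pr.1 (hIP ha) hxa
  obtain ⟨n, hn⟩ := this
  exact ⟨n, by rw [pow_succ]; exact Ideal.mul_mem_right _ _ hn⟩

lemma mem_basicOpen_pow {U : X.Opens} {b : Γ(X, U)} {x : X} (n : ℕ) :
    x ∈ X.basicOpen (b ^ (n + 1)) ↔ x ∈ X.basicOpen b := by
  rw [X.basicOpen_pow b (n := n + 1) (Nat.succ_pos n)]

/-- functions vanishing outside `U` -/
def supp (U : X.Opens) : Ideal Γ(X, ⊤) where
  carrier := {b | X.basicOpen b ≤ U}
  zero_mem' := by simp
  add_mem' := by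
    intro a b ha hb
    exact (X.basicOpen_add_le _ _).trans (sup_le ha hb)
  smul_mem' := by
    intro c x hx
    change X.basicOpen (c * x) ≤ U
    rw [X.basicOpen_mul]
    exact inf_le_right.trans hx

lemma mem_supp {U : X.Opens} {b : Γ(X, ⊤)} : b ∈ supp U ↔ X.basicOpen b ≤ U := Iff.rfl

lemma exists_pt {j : W ⟶ X} {q : W ⟶ Z} {f : X ⟶ Y} {i : Z ⟶ Y} (sq : IsPullback j q f i)
    (x : X) (z : Z) (h : f x = i z) : ∃ w, j w = x ∧ q w = z := by
  obtain ⟨p, h1, h2⟩ := Scheme.Pullback.exists_preimage_pullback x z h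
  refine ⟨sq.isoPullback.inv p, ?_, ?_⟩
  · rw [← Scheme.Hom.comp_apply, sq.isoPullback_inv_fst, h1]
  · rw [← Scheme.Hom.comp_apply, sq.isoPullback_inv_snd, h2]

lemma L1 {j : W ⟶ X} {q : W ⟶ Z} {f : X ⟶ Y} {i : Z ⟶ Y} (sq : IsPullback j q f i)
    [IsAffine X] [IsAffine Z] [IsClosedImmersion i] [IsFinite f] (hs : Function.Surjective f)
    (H : ∀ (b : Γ(X, ⊤)) (h : Γ(Z, ⊤)), gpb j b = gpb q h →
      ∃ g : Γ(Y, ⊤), ∀ y, y ∈ Y.basicOpen g ↔ ∀ x, f x = y → x ∈ X.basicOpen b)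
    (y : Y) (U : Y.Opens) (hy : y ∈ U) : ∃ g : Γ(Y, ⊤), y ∈ Y.basicOpen g ∧ Y.basicOpen g ≤ U := by
  have : IsClosedImmersion j :=
    MorphismProperty.of_isPullback (P := @IsClosedImmersion) sq.flip inferInstance
  have : IsAffine W := isAffine_of_isAffineHom j
  have hjs : Function.Surjective (gpb j) := j.app_surjective ⊤ (isAffineOpen_top X)
  have hcomm : ∀ w, f (j w) = i (q w) := fun w => by
    rw [← Scheme.Hom.comp_apply, ← Scheme.Hom.comp_apply, sq.w]
  suffices ∃ (b : Γ(X, ⊤)) (h : Γ(Z, ⊤)), gpb j b = gpb q h ∧ b ∈ supp (f ⁻¹ᵁ U) ∧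
      ∀ x, f x = y → x ∈ X.basicOpen b by
    obtain ⟨b, h, e, hb, hx⟩ := this
    obtain ⟨g, hg⟩ := H b h e
    refine ⟨g, (hg y).2 hx, fun y' hy' => ?_⟩
    obtain ⟨x, rfl⟩ := hs y'
    exact hb ((hg _).1 hy' x rfl)
  by_cases hyi : y ∈ Set.range i
  · obtain ⟨z, rfl⟩ := hyi
    obtain ⟨h, hz, hU⟩ := exists_basicOpen (i ⁻¹ᵁ U) z hy
    obtain ⟨n, hn⟩ := rad ((supp (f ⁻¹ᵁ U)).map (gpb j)) (gpb q h) (by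
      intro w hw
      rw [basicOpen_gpb] at hw
      have h1 : q w ∈ i ⁻¹ᵁ U := hU hw
      have h2 : j w ∈ f ⁻¹ᵁ U := by
        change f (j w) ∈ U
        rw [hcomm]; exact h1
      obtain ⟨a, ha, haU⟩ := exists_basicOpen _ _ h2
      refine ⟨gpb j a, Ideal.mem_map_of_mem _ (mem_supp.2 haU), ?_⟩
      rw [basicOpen_gpb]; exact ha)
    obtain ⟨v, hv, hvn⟩ := (Ideal.mem_map_iff_of_surjective _ hjs).1 hn
    refine ⟨v, h ^ (n + 1), by rw [hvn, map_pow], hv, fun x hx => ?_⟩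
    obtain ⟨w, rfl, rfl⟩ := exists_pt sq x z hx
    change w ∈ j ⁻¹ᵁ X.basicOpen v
    rw [← basicOpen_gpb, hvn, mem_basicOpen_pow, basicOpen_gpb]
    exact hz
  · have hfin : (f ⁻¹' {y}).Finite := f.finite_preimage_singleton y
    let M := supp (f ⁻¹ᵁ U) ⊓ RingHom.ker (gpb j)
    have key : ∀ x, f x = y → ¬ M ≤ pr (U := ⊤) x trivial := by
      intro x hx hM
      let V : X.Opens := ⟨(Set.range j)ᶜ, j.isClosedEmbedding.isClosed_range.isOpen_compl⟩
      obtain ⟨b, hb, hbU⟩ := exists_basicOpen (f ⁻¹ᵁ U ⊓ V) x ⟨by change f x ∈ U; rwa [hx], by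
        rintro ⟨w, rfl⟩
        exact hyi ⟨q w, by rw [← hcomm, hx]⟩⟩
      obtain ⟨n, hn⟩ := rad ⊥ (gpb j b) (by
        intro w hw
        rw [basicOpen_gpb] at hw
        exact absurd ⟨w, rfl⟩ (hbU hw).2)
      have h1 : b ^ (n + 1) ∈ M := by
        refine ⟨mem_supp.2 ?_, ?_⟩
        · intro x hx
          rw [mem_basicOpen_pow] at hx
          exact (hbU hx).1
        · change gpb j (b ^ (n + 1)) = 0
          rw [map_pow]; exact hn
      have := mem_pr.1 (hM h1)
      rw [mem_basicOpen_pow] at this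
      exact this hb
    have : ¬ ((M : Set Γ(X, ⊤)) ⊆ ⋃ x ∈ (hfin.toFinset : Set X), pr (U := ⊤) x trivial) := by
      rw [Ideal.subset_union_prime (Classical.choice (hs y).nonempty)
        (Classical.choice (hs y).nonempty) (fun x _ _ _ => pr_prime (U := ⊤) x trivial)]
      rintro ⟨x, hx, hx'⟩
      exact key x (by simpa using hx) hx'
    rw [Set.not_subset] at this
    obtain ⟨b, hb, hb'⟩ := this
    refine ⟨b, 0, ?_, hb.1, fun x hx => ?_⟩
    · rw [map_zero]; exact hb.2
    · by_contra hcon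
      exact hb' (Set.mem_biUnion (by simpa using hx) (mem_pr.2 hcon))

lemma gpb_comp (f : X ⟶ Y) (g : Y ⟶ Z) (a : Γ(Z, ⊤)) : gpb (f ≫ g) a = gpb f (gpb g a) := by
  simp only [gpb, Scheme.Hom.comp_appTop]; rfl

lemma L {j : W ⟶ X} {q : W ⟶ Z} {f : X ⟶ Y} {i : Z ⟶ Y} (sq : IsPullback j q f i)
    [IsAffine X] [IsAffine Z] [IsClosedImmersion i] [IsFinite f] (hs : Function.Surjective f)
    (hinj : Function.Injective (gpb f))
    (H : ∀ (b : Γ(X, ⊤)) (h : Γ(Z, ⊤)), gpb j b = gpb q h → (gpb f).IsIntegralElem b ∧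
      ∃ g : Γ(Y, ⊤), ∀ y, y ∈ Y.basicOpen g ↔ ∀ x, f x = y → x ∈ X.basicOpen b) :
    IsAffine Y := by
  have : IsClosedImmersion j :=
    MorphismProperty.of_isPullback (P := @IsClosedImmersion) sq.flip inferInstance
  have hjs : Function.Surjective (gpb j) := j.app_surjective ⊤ (isAffineOpen_top X)
  have hcomm : ∀ a, gpb j (gpb f a) = gpb q (gpb i a) := fun a => by
    rw [← gpb_comp, ← gpb_comp, sq.w]
  let s : Set Γ(Y, ⊤) := {g | IsAffineOpen (Y.basicOpen g)}
  have hs' : ∀ y, ∃ g ∈ s, y ∈ Y.basicOpen g := by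
    intro y
    obtain ⟨_, ⟨U, hU, rfl⟩, hyU, -⟩ := Y.isBasis_affineOpens.exists_subset_of_mem_open
      (Set.mem_univ y) isOpen_univ
    obtain ⟨g, hy, hgU⟩ := L1 sq hs (fun b h e => (H b h e).2) y U hyU
    refine ⟨g, ?_, hy⟩
    have h1 : Y.basicOpen (rs (le_top : U ≤ ⊤) g) = Y.basicOpen g := by
      rw [basicOpen_rs]; exact inf_eq_right.2 hgU
    change IsAffineOpen _
    rw [← h1]
    exact IsAffineOpen.basicOpen hU _
  refine isAffine_of_isAffineOpen_basicOpen s ?_ (fun _ h => h)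
  have t1 : (Ideal.span s).map (gpb f) = ⊤ := by
    refine ideal_top _ fun x => ?_
    obtain ⟨g, hg, hx⟩ := hs' (f x)
    exact ⟨gpb f g, Ideal.mem_map_of_mem _ (Ideal.subset_span hg), by rw [basicOpen_gpb]; exact hx⟩
  have t2 : (Ideal.span s).map (gpb i) = ⊤ := by
    refine ideal_top _ fun x => ?_
    obtain ⟨g, hg, hx⟩ := hs' (i x)
    exact ⟨gpb i g, Ideal.mem_map_of_mem _ (Ideal.subset_span hg), by rw [basicOpen_gpb]; exact hx⟩
  let B0 : Subring Γ(X, ⊤) := (gpb q).range.comap (gpb j)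
  let φ : Γ(Y, ⊤) →+* B0 := (gpb f).codRestrict B0 (fun a => ⟨gpb i a, (hcomm a).symm⟩)
  have hφ : ∀ a, (φ a : Γ(X, ⊤)) = gpb f a := fun a => rfl
  have hφi : Function.Injective φ := fun a b h => hinj (congrArg Subtype.val h)
  have hφint : φ.IsIntegral := by
    rintro ⟨b, h, hb⟩
    obtain ⟨p, hp, hp'⟩ := (H b h hb.symm).1
    refine ⟨p, hp, Subtype.ext ?_⟩
    exact (Polynomial.hom_eval₂ p φ B0.subtype _).trans hp'
  rw [← Ideal.map_eq_top_iff φ hφi hφint]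
  set J := (Ideal.span s).map φ
  have k1 : ∀ c : B0, gpb j c = 0 → c ∈ J := by
    have : ∀ x ∈ (Ideal.span s).map (gpb f), ∀ c : B0, gpb j c = 0 →
        ∃ d ∈ J, (d : Γ(X, ⊤)) = x * c := by
      intro x hx
      induction hx using Submodule.span_induction with
      | mem x hx =>
        obtain ⟨g, hg, rfl⟩ := hx
        exact fun c hc => ⟨φ g * c, Ideal.mul_mem_right _ _ (Ideal.mem_map_of_mem _ hg), rfl⟩
      | zero => exact fun c hc => ⟨0, zero_mem _, by simp⟩
      | add x y _ _ hx hy =>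
        intro c hc
        obtain ⟨d, hd, hd'⟩ := hx c hc
        obtain ⟨e, he, he'⟩ := hy c hc
        exact ⟨d + e, add_mem hd he, by simp [hd', he', add_mul]⟩
      | smul b x _ hx =>
        intro c hc
        have h0 : gpb j (b * c) = 0 := by rw [map_mul, hc, mul_zero]
        obtain ⟨d, hd, hd'⟩ := hx ⟨b * c, 0, by rw [h0, map_zero]⟩ h0
        exact ⟨d, hd, by rw [hd', smul_eq_mul]; ring⟩
    intro c hc
    obtain ⟨d, hd, hd'⟩ := this 1 (t1 ▸ trivial) c hc
    rw [one_mul] at hd'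
    rwa [← Subtype.ext hd']
  have k2 : ∀ t ∈ (Ideal.span s).map (gpb i), ∃ β ∈ J, gpb j (β : Γ(X, ⊤)) = gpb q t := by
    intro t ht
    induction ht using Submodule.span_induction with
    | mem x hx =>
      obtain ⟨g, hg, rfl⟩ := hx
      exact ⟨φ g, Ideal.mem_map_of_mem _ hg, hcomm g⟩
    | zero => exact ⟨0, zero_mem _, by simp⟩
    | add x y _ _ hx hy =>
      obtain ⟨d, hd, hd'⟩ := hx
      obtain ⟨e, he, he'⟩ := hy
      exact ⟨d + e, add_mem hd he, by simp [hd', he']⟩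
    | smul b x _ hx =>
      obtain ⟨d, hd, hd'⟩ := hx
      obtain ⟨β, hβ⟩ := hjs (gpb q b)
      exact ⟨⟨β, b, hβ.symm⟩ * d, Ideal.mul_mem_left _ _ hd, by simp [hd', hβ]⟩
  obtain ⟨β, hβ, hβ'⟩ := k2 1 (t2 ▸ trivial)
  rw [Ideal.eq_top_iff_one]
  have : (1 : B0) - β ∈ J := k1 _ (by simp [hβ'])
  simpa using add_mem this hβ

end Chev

namespace Chev
variable {X Y Z W : Scheme.{u}}

lemma po_ker {R S T W : CommRingCat.{u}} {α : R ⟶ S} {β : R ⟶ T} {γ : S ⟶ W} {δ : T ⟶ W}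
    (h : IsPushout α β γ δ) (hβ : Function.Surjective β.hom) (s : S) (t : T)
    (e : γ.hom s = δ.hom t) :
    ∃ r : R, β.hom r = t ∧ s - α.hom r ∈ (RingHom.ker β.hom).map α.hom := by
  obtain ⟨r, rfl⟩ := hβ t
  refine ⟨r, rfl, ?_⟩
  let J := (RingHom.ker β.hom).map α.hom
  let m : S ⟶ CommRingCat.of (S ⧸ J) := CommRingCat.ofHom (Ideal.Quotient.mk J)
  let φ : (T : Type u) →+* (S ⧸ J) := RingHom.liftOfSurjective β.hom hβ
    ⟨(Ideal.Quotient.mk J).comp α.hom, fun x hx => by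
      rw [RingHom.mem_ker, RingHom.comp_apply, Ideal.Quotient.eq_zero_iff_mem]
      exact Ideal.mem_map_of_mem _ hx⟩
  have hφ : ∀ r, φ (β.hom r) = Ideal.Quotient.mk J (α.hom r) := fun r =>
    RingHom.liftOfRightInverse_comp_apply _ _ _ _ r
  let n : T ⟶ CommRingCat.of (S ⧸ J) := CommRingCat.ofHom φ
  have hw : α ≫ m = β ≫ n := by
    ext r
    exact (hφ r).symm
  have h1 : ∀ x, (h.desc m n hw).hom (γ.hom x) = Ideal.Quotient.mk J x := fun x =>
    ConcreteCategory.congr_hom (h.inl_desc m n hw) x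
  have h2 : ∀ x, (h.desc m n hw).hom (δ.hom x) = φ x := fun x =>
    ConcreteCategory.congr_hom (h.inr_desc m n hw) x
  rw [← Ideal.Quotient.eq, ← h1, e, h2, hφ]

lemma pre_comp {j : W ⟶ X} {q : W ⟶ Z} {f : X ⟶ Y} {i : Z ⟶ Y} (w : j ≫ f = q ≫ i) (U : Y.Opens) :
    q ⁻¹ᵁ i ⁻¹ᵁ U = j ⁻¹ᵁ f ⁻¹ᵁ U := by
  rw [← Scheme.Hom.comp_preimage, ← w]; rfl

lemma loc_dec {j : W ⟶ X} {q : W ⟶ Z} {f : X ⟶ Y} {i : Z ⟶ Y} (sq : IsPullback j q f i)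
    [IsClosedImmersion i] [IsAffineHom f] (U : Y.affineOpens) (b : Γ(X, ⊤)) (h : Γ(Z, ⊤))
    (e : gpb j b = gpb q h) :
    ∃ r : Γ(Y, U.1), pb i U.1 r = rs le_top h ∧
      rs le_top b - pb f U.1 r ∈ (i.ker.ideal U).map (pb f U.1) := by
  have hp := (isIso_pushoutSection_iff sq (US := U.1) (UT := i ⁻¹ᵁ U.1) (UX := f ⁻¹ᵁ U.1)
    (UY := j ⁻¹ᵁ f ⁻¹ᵁ U.1) le_rfl le_rfl (by rw [pre_comp sq.w, inf_idem])).1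
      (isIso_pushoutSection_of_isAffineOpen sq _ _ _ U.2 (U.2.preimage i) (U.2.preimage f))
  have hβ : (i.appLE U.1 (i ⁻¹ᵁ U.1) le_rfl) = i.app U.1 := by simp [Scheme.Hom.appLE]
  have hα : (f.appLE U.1 (f ⁻¹ᵁ U.1) le_rfl) = f.app U.1 := by simp [Scheme.Hom.appLE]
  obtain ⟨r, hr, hr'⟩ := po_ker hp (by rw [hβ]; exact i.app_surjective U.1 U.2)
    (rs le_top b) (rs le_top h) (by
      have h1 : (j.appLE (f ⁻¹ᵁ U.1) (j ⁻¹ᵁ f ⁻¹ᵁ U.1) le_rfl).hom (rs le_top b) =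
          rs le_top (gpb j b) := by
        rw [rs_gpb]
        simp [Scheme.Hom.appLE, pb]
      have h2 : (q.appLE (i ⁻¹ᵁ U.1) (j ⁻¹ᵁ f ⁻¹ᵁ U.1) (pre_comp sq.w U.1).ge).hom (rs le_top h) =
          rs le_top (gpb q h) := by
        rw [← rs_rs (le_top : q ⁻¹ᵁ i ⁻¹ᵁ U.1 ≤ ⊤) (pre_comp sq.w U.1).ge, rs_gpb]
        rfl
      exact h1.trans ((congrArg _ e).trans h2.symm))
  rw [hβ] at hr
  refine ⟨r, hr, ?_⟩
  rw [hβ, hα] at hr'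
  rw [Scheme.Hom.ker_apply]
  exact hr'

end Chev

namespace Chev
variable {X Y Z W : Scheme.{u}}

lemma gen_mem [IsIntegral Y] {U : Y.Opens} (hU : (U : Set Y).Nonempty) : genericPoint Y ∈ U :=
  ((genericPoint_spec Y).mem_open_set_iff U.isOpen).mpr (by simpa using hU)

lemma f_gen (f : X ⟶ Y) [IsIntegral X] [IsIntegral Y] (hs : Function.Surjective f) :
    f (genericPoint X) = genericPoint Y := by
  have h := (genericPoint_spec X).image f.continuous
  rw [Set.image_univ, hs.range_eq, closure_univ] at h
  exact h.eq (genericPoint_spec Y)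

lemma ff_exists (f : X ⟶ Y) [IsIntegral X] [IsIntegral Y] (hs : Function.Surjective f) :
    ∃ (K L : Type u) (_ : Field K) (_ : Field L) (_ : Algebra K L)
      (κ : ∀ U : Y.Opens, (U : Set Y).Nonempty → Γ(Y, U) →+* K)
      (σ : ∀ V : X.Opens, (V : Set X).Nonempty → Γ(X, V) →+* L),
      (∀ U V hU hV (h : V ≤ U) r, κ V hV (rs h r) = κ U hU r) ∧
      (∀ U V hU hV (h : V ≤ U) r, σ V hV (rs h r) = σ U hU r) ∧
      (∀ U hU, Function.Injective (κ U hU)) ∧ (∀ U hU, Function.Injective (σ U hU)) ∧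
      (∀ U hU hV r, σ (f ⁻¹ᵁ U) hV (pb f U r) = algebraMap K L (κ U hU r)) ∧
      (∀ U hU, IsAffineOpen U → @IsFractionRing Γ(Y, U) _ K _ (κ U hU).toAlgebra) ∧
      (∀ U hU, IsAffineOpen U → @IsFractionRing Γ(X, U) _ L _ (σ U hU).toAlgebra) := by
  let φ : Y.functionField ⟶ X.functionField :=
    Y.presheaf.stalkSpecializes (specializes_of_eq (f_gen f hs)) ≫ f.stalkMap (genericPoint X)
  refine ⟨Y.functionField, X.functionField, inferInstance, inferInstance, φ.hom.toAlgebra,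
    fun U hU => (Y.presheaf.germ U (genericPoint Y) (gen_mem hU)).hom,
    fun V hV => (X.presheaf.germ V (genericPoint X) (gen_mem hV)).hom, ?_, ?_, ?_, ?_, ?_, ?_, ?_⟩
  · intro U V hU hV h r
    exact Y.presheaf.germ_res_apply (homOfLE h) _ (gen_mem hV) r
  · intro U V hU hV h r
    exact X.presheaf.germ_res_apply (homOfLE h) _ (gen_mem hV) r
  · intro U hU
    exact germ_injective_of_isIntegral _ _ _
  · intro U hU
    exact germ_injective_of_isIntegral _ _ _
  · intro U hU hV r
    have hm : f (genericPoint X) ∈ U := by rw [f_gen f hs]; exact gen_mem hU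
    have h1 := ConcreteCategory.congr_hom (f.germ_stalkMap U (genericPoint X) hm) r
    have h2 := ConcreteCategory.congr_hom (Y.presheaf.germ_stalkSpecializes (U := U)
      (y := genericPoint Y) (x := f (genericPoint X)) (gen_mem hU)
      (specializes_of_eq (f_gen f hs))) r
    refine h1.symm.trans ?_
    exact congrArg (f.stalkMap (genericPoint X)) h2.symm
  · intro U hU hUa
    have : Nonempty U := ⟨⟨_, hU.some_mem⟩⟩
    exact functionField_isFractionRing_of_isAffineOpen Y U hUa
  · intro U hU hUa
    have : Nonempty U := ⟨⟨_, hU.some_mem⟩⟩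
    exact functionField_isFractionRing_of_isAffineOpen X U hUa

lemma alg_fin {R S K L : Type u} [CommRing R] [CommRing S] [Field K] [Field L] [Algebra K L]
    (ρ : R →+* S) (κ : R →+* K) (σ : S →+* L) (hc : ∀ r, σ (ρ r) = algebraMap K L (κ r))
    (hρ : ρ.Finite) (hκ : @IsFractionRing R _ K _ κ.toAlgebra)
    (hσ : @IsFractionRing S _ L _ σ.toAlgebra) : FiniteDimensional K L := by
  let := ρ.toAlgebra
  let := κ.toAlgebra
  let := σ.toAlgebra
  let := (σ.comp ρ).toAlgebra
  have : Module.Finite R S := hρ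
  have : IsScalarTower R S L := .of_algebraMap_eq fun r => rfl
  have : IsScalarTower R K L := .of_algebraMap_eq fun r => hc r
  have : IsDomain R := Function.Injective.isDomain κ (IsFractionRing.injective R K)
  have : IsDomain S := Function.Injective.isDomain σ (IsFractionRing.injective S L)
  have hRL : Function.Injective (algebraMap R L) := by
    rw [IsScalarTower.algebraMap_eq R K L]
    exact (algebraMap K L).injective.comp (IsFractionRing.injective R K)
  have : FaithfulSMul R S := by
    rw [faithfulSMul_iff_algebraMap_injective]
    rw [IsScalarTower.algebraMap_eq R S L] at hRL
    exact Function.Injective.of_comp hRL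
  have : IsLocalization (Algebra.algebraMapSubmonoid S (nonZeroDivisors R)) L := inferInstance
  exact Module.Finite.of_isLocalization R S (nonZeroDivisors R)

lemma alg_cp {R S K L : Type u} [CommRing R] [CommRing S] [Field K] [Field L] [Algebra K L]
    [FiniteDimensional K L]
    (ρ : R →+* S) (κ : R →+* K) (σ : S →+* L) (hc : ∀ r, σ (ρ r) = algebraMap K L (κ r))
    (hρ : ρ.Finite) (hκ : @IsFractionRing R _ K _ κ.toAlgebra) :
    ∃ a : R, a ≠ 0 ∧ ∀ (r : R) (s : S), s - ρ r ∈ (Ideal.span {a}).map ρ →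
      (Algebra.lmul K L (σ s)).charpoly ∈ Polynomial.lifts κ := by
  let := ρ.toAlgebra
  let := κ.toAlgebra
  let := σ.toAlgebra
  let := (σ.comp ρ).toAlgebra
  have : Module.Finite R S := hρ
  have : IsScalarTower R S L := .of_algebraMap_eq fun r => rfl
  have : IsScalarTower R K L := .of_algebraMap_eq fun r => hc r
  have : IsDomain R := Function.Injective.isDomain κ (IsFractionRing.injective R K)
  obtain ⟨a, ha, h⟩ := chev_charpoly (R := R) (S := S) (K := K) (L := L)
  refine ⟨a, ha, fun r s hs => ?_⟩
  rw [Ideal.map_span, Set.image_singleton, Ideal.mem_span_singleton] at hs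
  obtain ⟨t, ht⟩ := hs
  have : σ s = algebraMap R L r + algebraMap R L a * algebraMap S L t := by
    have : s = ρ r + ρ a * t := by rw [← ht]; ring
    rw [this, map_add, map_mul]; rfl
  rw [this]
  exact h r t

lemma alg_norm {R S K L : Type u} [CommRing R] [CommRing S] [Field K] [Field L] [Algebra K L]
    [FiniteDimensional K L]
    (ρ : R →+* S) (κ : R →+* K) (σ : S →+* L) (hc : ∀ r, σ (ρ r) = algebraMap K L (κ r))
    (hρ : ρ.Finite) (hκ : @IsFractionRing R _ K _ κ.toAlgebra) (b : S) (g : R)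
    (hg : κ g = (Algebra.lmul K L (σ b)).charpoly.coeff 0)
    (p : Ideal R) [p.IsPrime] (hp : g ∈ p) :
    ∃ q : Ideal S, q.IsPrime ∧ q.comap ρ = p ∧ b ∈ q := by
  let := ρ.toAlgebra
  let := κ.toAlgebra
  let := σ.toAlgebra
  let := (σ.comp ρ).toAlgebra
  have : Module.Finite R S := hρ
  have : IsScalarTower R S L := .of_algebraMap_eq fun r => rfl
  have : IsScalarTower R K L := .of_algebraMap_eq fun r => hc r
  have : IsDomain R := Function.Injective.isDomain κ (IsFractionRing.injective R K)
  exact chev_norm (K := K) (L := L) b g hg p hp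

end Chev

namespace Chev
variable {X Y Z W : Scheme.{u}}

lemma mem_van (T : TopologicalSpace.Closeds Y) (U : Y.affineOpens) (s : Γ(Y, U.1)) :
    s ∈ (Scheme.IdealSheafData.vanishingIdeal T).ideal U ↔ ∀ y ∈ T, y ∉ Y.basicOpen s := by
  rw [Scheme.IdealSheafData.vanishingIdeal_ideal, PrimeSpectrum.mem_vanishingIdeal]
  have key : ∀ p : PrimeSpectrum Γ(Y, U.1), s ∈ p.asIdeal ↔ U.2.fromSpec p ∉ Y.basicOpen s := by
    intro p
    have : U.2.fromSpec p ∈ Y.basicOpen s ↔ p ∈ PrimeSpectrum.basicOpen s := by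
      rw [← U.2.fromSpec_preimage_basicOpen]; rfl
    rw [this, PrimeSpectrum.mem_basicOpen, not_not]
  constructor
  · intro h y hy hys
    have hyU : y ∈ Set.range U.2.fromSpec := by
      rw [U.2.range_fromSpec]; exact Y.basicOpen_le s hys
    obtain ⟨p, rfl⟩ := hyU
    exact (key p).1 (h p hy) hys
  · intro h p hp
    exact (key p).2 (h _ hp)

lemma mem_rad {U : Y.Opens} (hU : IsAffineOpen U) (a s : Γ(Y, U))
    (h : Y.basicOpen s ≤ Y.basicOpen a) : s ∈ (Ideal.span {a}).radical := by
  rw [Ideal.radical_eq_sInf, Ideal.mem_sInf]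
  rintro P ⟨hIP, hP⟩
  obtain ⟨x, hx, rfl⟩ := exists_pr hU P
  rw [mem_pr]
  intro hxb
  exact mem_pr.1 (hIP (Ideal.mem_span_singleton_self a)) (h hxb)

lemma cond [IsIntegral Y] [IsNoetherian Y] {ι : Type*} [Finite ι] (U : ι → Y.affineOpens)
    (a : ∀ k, Γ(Y, (U k).1)) (ha : ∀ k, a k ≠ 0) :
    ∃ c : Y.IdealSheafData, (∀ k, c.ideal (U k) ≤ Ideal.span {a k}) ∧
      genericPoint Y ∉ c.support := by
  let T : TopologicalSpace.Closeds Y :=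
    ⟨⋃ k, ((Y.basicOpen (a k) : Y.Opens) : Set Y)ᶜ,
      isClosed_iUnion_of_finite fun k => (Y.basicOpen (a k)).isOpen.isClosed_compl⟩
  obtain ⟨n, hn⟩ := pow_bound U (Scheme.IdealSheafData.vanishingIdeal T)
    (fun k => Ideal.span {a k}) (fun k s hs => by
      rw [mem_van] at hs
      refine mem_rad (U k).2 _ _ fun y hy => ?_
      by_contra hcon
      exact hs y (Set.mem_iUnion.2 ⟨k, hcon⟩) hy)
  refine ⟨_, hn, ?_⟩
  rw [Scheme.IdealSheafData.support_pow_succ]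
  have hle : (Scheme.IdealSheafData.vanishingIdeal T).support ≤ T := by
    intro y hy
    obtain ⟨_, ⟨V, hV, rfl⟩, hyV, -⟩ := Y.isBasis_affineOpens.exists_subset_of_mem_open
      (Set.mem_univ y) isOpen_univ
    by_contra hyT
    obtain ⟨s, hs, hys⟩ := hV.exists_basicOpen_le (V := ⟨(T : Set Y)ᶜ, T.isClosed.isOpen_compl⟩)
      ⟨y, hyT⟩ hyV
    rw [Scheme.IdealSheafData.mem_support_iff_of_mem (U := ⟨V, hV⟩) hyV,
      Scheme.mem_zeroLocus_iff] at hy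
    exact hy s ((mem_van T ⟨V, hV⟩ s).2 fun z hz hzs => hs hzs hz) hys
  intro hg
  obtain ⟨k, hk⟩ := Set.mem_iUnion.1 (hle hg)
  refine hk (gen_mem ?_)
  rw [Set.nonempty_iff_ne_empty]
  intro h
  exact ha k ((basicOpen_eq_bot_iff _).1 (TopologicalSpace.Opens.ext h))

lemma fin_cover' (Y : Scheme.{u}) [CompactSpace Y] : ∃ (ι : Type u) (_ : Finite ι)
    (U : ι → Y.affineOpens), (∀ k, ((U k).1 : Set Y).Nonempty) ∧ ∀ y, ∃ k, y ∈ (U k).1 := by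
  obtain ⟨ι, _, U, hU⟩ := fin_cover Y
  refine ⟨{k // ((U k).1 : Set Y).Nonempty}, inferInstance, fun k => U k.1, fun k => k.2,
    fun y => ?_⟩
  obtain ⟨k, hk⟩ := hU y
  exact ⟨⟨k, ⟨y, hk⟩⟩, hk⟩

lemma comap_pr (f : X ⟶ Y) {U : Y.Opens} (x : X) (hx : x ∈ f ⁻¹ᵁ U) (hfx : f x ∈ U) :
    (pr x hx).comap (pb f U) = pr (f x) hfx := by
  ext r
  rw [Ideal.mem_comap, mem_pr, mem_pr, basicOpen_pb]; rfl

end Chev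

namespace Chev
variable {X Y Z W : Scheme.{u}}

lemma cayley {K L : Type u} [Field K] [Field L] [Algebra K L] [FiniteDimensional K L] (x : L) :
    Polynomial.aeval x (Algebra.lmul K L x).charpoly = 0 := by
  have h := LinearMap.aeval_self_charpoly (Algebra.lmul K L x)
  rw [Polynomial.aeval_algHom_apply] at h
  have := LinearMap.congr_fun h 1
  simpa using this

lemma int_lift {A B K L : Type u} [CommRing A] [CommRing B] [Field K] [Field L] [Algebra K L]
    [FiniteDimensional K L] (φ : A →+* B) (κ : A →+* K) (σ : B →+* L)
    (hσ : Function.Injective σ) (hc : ∀ a, σ (φ a) = algebraMap K L (κ a)) (b : B)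
    (h : ∀ n, ∃ g, κ g = (Algebra.lmul K L (σ b)).charpoly.coeff n) :
    φ.IsIntegralElem b ∧ ∃ g c, κ g = (Algebra.lmul K L (σ b)).charpoly.coeff 0 ∧
      φ g = b * c := by
  have h1 : (Algebra.lmul K L (σ b)).charpoly ∈ Polynomial.lifts κ :=
    (Polynomial.lifts_iff_coeff_lifts _).2 h
  obtain ⟨Q, hQ, -, hm⟩ := Polynomial.lifts_and_natDegree_eq_and_monic h1
    (LinearMap.charpoly_monic _)
  have h0 : Polynomial.eval₂ φ b Q = 0 := by
    apply hσ
    rw [map_zero, Polynomial.hom_eval₂, ← cayley (K := K) (σ b), ← hQ, Polynomial.aeval_def,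
      Polynomial.eval₂_map]
    congr 1
    ext a
    exact hc a
  refine ⟨⟨Q, hm, h0⟩, Q.coeff 0, - Polynomial.eval₂ φ b Q.divX, ?_, ?_⟩
  · rw [← hQ, Polynomial.coeff_map]
  · rw [← Polynomial.divX_mul_X_add Q, Polynomial.eval₂_add, Polynomial.eval₂_mul,
      Polynomial.eval₂_X, Polynomial.eval₂_C] at h0
    linear_combination h0

lemma integral_case (f : X ⟶ Y) [IsIntegral X] [IsIntegral Y] [IsNoetherian Y] [IsFinite f]
    [IsAffine X] (hs : Function.Surjective f)
    (IH : ∀ (Z : Scheme.{u}) (i : Z ⟶ Y), IsClosedImmersion i → ¬ Function.Surjective i →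
      IsAffine Z) : IsAffine Y := by
  obtain ⟨ι, _, U, hne, hU⟩ := fin_cover' Y
  obtain ⟨K, L, _, _, _, κ, σ, hκr, hσr, hκi, hσi, hc, hκf, hσf⟩ := ff_exists f hs
  have hne' : ∀ U : Y.Opens, (U : Set Y).Nonempty → ((f ⁻¹ᵁ U : X.Opens) : Set X).Nonempty := by
    rintro U ⟨y, hy⟩
    obtain ⟨x, rfl⟩ := hs y
    exact ⟨x, hy⟩
  have hfin : ∀ k, (pb f (U k).1).Finite := fun k => IsFinite.finite_app f _ (U k).2
  have hY : ((⊤ : Y.Opens) : Set Y).Nonempty := ⟨genericPoint Y, trivial⟩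
  have hX : ((⊤ : X.Opens) : Set X).Nonempty := ⟨genericPoint X, trivial⟩
  obtain ⟨k0, -⟩ := hU (genericPoint Y)
  have : FiniteDimensional K L := alg_fin (pb f (U k0).1) (κ _ (hne k0)) (σ _ (hne' _ (hne k0)))
    (hc _ _ _) (hfin k0) (hκf _ _ (U k0).2) (hσf _ _ ((U k0).2.preimage f))
  choose a ha0 ha using fun k => alg_cp (pb f (U k).1) (κ _ (hne k)) (σ _ (hne' _ (hne k)))
    (hc _ _ _) (hfin k) (hκf _ _ (U k).2)
  obtain ⟨c, hcU, hcg⟩ := cond U a ha0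
  have hZ : IsAffine c.subscheme := IH _ c.subschemeι inferInstance fun h => hcg (by
    have : genericPoint Y ∈ Set.range c.subschemeι := h _
    rw [Scheme.IdealSheafData.range_subschemeι] at this
    exact this)
  refine Chev.L (IsPullback.of_hasPullback f c.subschemeι) hs ?_ ?_
  · intro x y hxy
    refine hκi ⊤ hY ((algebraMap K L).injective ?_)
    rw [← hc ⊤ hY hX, ← hc ⊤ hY hX]
    exact congrArg _ hxy
  intro b h e
  have hlift : ∀ k, (Algebra.lmul K L (σ ⊤ hX b)).charpoly ∈ Polynomial.lifts (κ _ (hne k)) := by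
    intro k
    obtain ⟨r, -, hr⟩ := loc_dec (IsPullback.of_hasPullback f c.subschemeι) (U k) b h e
    rw [Scheme.IdealSheafData.ker_subschemeι] at hr
    have := ha k r _ (Ideal.map_mono (hcU k) hr)
    rwa [hσr] at this
  have hglob : ∀ n, ∃ g, κ ⊤ hY g = (Algebra.lmul K L (σ ⊤ hX b)).charpoly.coeff n := by
    intro n
    have : ∀ k, ∃ g, κ _ (hne k) g = (Algebra.lmul K L (σ ⊤ hX b)).charpoly.coeff n := fun k =>
      (Polynomial.lifts_iff_coeff_lifts _).1 (hlift k) n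
    choose g hg using this
    obtain ⟨t, ht⟩ := glue (fun k => (U k).1) hU g (by
      intro k l
      have hkl : (((U k).1 ⊓ (U l).1 : Y.Opens) : Set Y).Nonempty :=
        ⟨genericPoint Y, gen_mem (hne k), gen_mem (hne l)⟩
      apply hκi _ hkl
      rw [hκr _ _ (hne k), hκr _ _ (hne l), hg, hg])
    refine ⟨t, ?_⟩
    rw [← hκr _ _ hY (hne k0) le_top, ht, hg]
  obtain ⟨hint, g, c', hg, hgc⟩ := int_lift (gpb f) (κ ⊤ hY) (σ ⊤ hX) (hσi _ _)
    (fun a => hc ⊤ hY hX a) b hglob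
  refine ⟨hint, g, fun y => ⟨?_, ?_⟩⟩
  · rintro hy x rfl
    have : x ∈ X.basicOpen (gpb f g) := by rw [basicOpen_gpb]; exact hy
    rw [hgc, Scheme.basicOpen_mul] at this
    exact this.1
  · intro hy
    by_contra hyg
    obtain ⟨k, hk⟩ := hU y
    obtain ⟨q, hq, hqp, hbq⟩ := alg_norm (pb f (U k).1) (κ _ (hne k)) (σ _ (hne' _ (hne k)))
      (hc _ _ _) (hfin k) (hκf _ _ (U k).2) (rs le_top b) (rs le_top g)
      (by rw [hκr _ _ hY, hσr _ _ hX, hg]) (pr y hk) (by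
        rw [mem_pr, basicOpen_rs]
        exact fun h => hyg h.2)
    obtain ⟨x, hx, rfl⟩ := exists_pr ((U k).2.preimage f) q
    rw [comap_pr f x hx hx] at hqp
    have := hy x (pr_inj (U k).2 hqp)
    rw [mem_pr, basicOpen_rs] at hbq
    exact hbq ⟨hx, this⟩

end Chev

namespace Chev
variable {X Y Z W : Scheme.{u}}

lemma red_inj (f : X ⟶ Y) [IsReduced Y] (hs : Function.Surjective f) (U : Y.Opens) :
    Function.Injective (pb f U) := by
  rw [injective_iff_map_eq_zero]
  intro s hs0
  apply (basicOpen_eq_bot_iff _).1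
  rw [eq_bot_iff]
  intro y hy
  obtain ⟨x, rfl⟩ := hs y
  have : x ∈ X.basicOpen (pb f U s) := by rw [basicOpen_pb]; exact hy
  rw [hs0, Scheme.basicOpen_zero] at this
  exact this

lemma pb_comp (f : X ⟶ Y) (g : Y ⟶ Z) (U : Z.Opens) (a : Γ(Z, U)) :
    pb (f ≫ g) U a = pb f (g ⁻¹ᵁ U) (pb g U a) := by
  simp only [pb, Scheme.Hom.comp_app]; rfl

lemma mem_ker_pb {R S : Type*} [CommRing R] [CommRing S] (ρ : R →+* S) (I : Ideal R)
    (h : ∀ u ∈ I, ∀ s, s * ρ u ∈ ρ.range) : ∀ t ∈ I.map ρ, t ∈ ρ.range := by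
  have : ∀ t ∈ I.map ρ, ∀ s, s * t ∈ ρ.range := by
    intro t ht
    induction ht using Submodule.span_induction with
    | mem x hx =>
      obtain ⟨u, hu, rfl⟩ := hx
      exact h u hu
    | zero => intro s; rw [mul_zero]; exact zero_mem _
    | add x y _ _ hx hy => intro s; rw [mul_add]; exact add_mem (hx s) (hy s)
    | smul a x _ hx => intro s; rw [smul_eq_mul, ← mul_assoc]; exact hx _
  intro t ht
  simpa using this t ht 1

lemma red_core {Y1 Y2 : Scheme.{u}} (f : X ⟶ Y) (i1 : Y1 ⟶ X) (i2 : Y2 ⟶ X)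
    (hext : ∀ (V : X.Opens) (s t : Γ(X, V)), pb i1 V s = pb i1 V t → pb i2 V s = pb i2 V t → s = t)
    [IsClosedImmersion (i1 ≫ f)] [IsClosedImmersion (i2 ≫ f)] [IsFinite f] [IsAffine X]
    [IsReduced Y] [CompactSpace Y] (hs : Function.Surjective f) (i : Z ⟶ Y) [IsClosedImmersion i]
    [IsAffine Z] (hi : i.ker = (i1 ≫ f).ker ⊔ (i2 ≫ f).ker) : IsAffine Y := by
  obtain ⟨ι, _, U, hU⟩ := fin_cover Y
  refine Chev.L (IsPullback.of_hasPullback f i) hs (red_inj f hs ⊤) ?_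
  intro b h e
  have h1 : ∀ k, ∃ r, pb f (U k).1 r = rs le_top b := by
    intro k
    obtain ⟨r, -, hr⟩ := loc_dec (IsPullback.of_hasPullback f i) (U k) b h e
    rw [hi, Scheme.IdealSheafData.ideal_sup, Pi.sup_apply, Ideal.map_sup,
      Submodule.mem_sup] at hr
    have k1 : ∀ t ∈ ((i1 ≫ f).ker.ideal (U k)).map (pb f (U k).1), t ∈ (pb f (U k).1).range := by
      apply mem_ker_pb
      intro u hu s
      rw [Scheme.Hom.ker_apply] at hu
      obtain ⟨v, hv⟩ := (i2 ≫ f).app_surjective (U k).1 (U k).2 (pb i2 _ s)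
      have hv' : pb i2 _ (pb f _ v) = pb i2 _ s := by rw [← pb_comp]; exact hv
      have hu' : pb i1 _ (pb f _ u) = 0 := by rw [← pb_comp]; exact hu
      refine ⟨v * u, hext _ _ _ ?_ ?_⟩
      · rw [map_mul, map_mul, map_mul, hu', mul_zero, mul_zero]
      · rw [map_mul, map_mul, map_mul, hv']
    have k2 : ∀ t ∈ ((i2 ≫ f).ker.ideal (U k)).map (pb f (U k).1), t ∈ (pb f (U k).1).range := by
      apply mem_ker_pb
      intro u hu s
      rw [Scheme.Hom.ker_apply] at hu
      obtain ⟨v, hv⟩ := (i1 ≫ f).app_surjective (U k).1 (U k).2 (pb i1 _ s)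
      have hv' : pb i1 _ (pb f _ v) = pb i1 _ s := by rw [← pb_comp]; exact hv
      have hu' : pb i2 _ (pb f _ u) = 0 := by rw [← pb_comp]; exact hu
      refine ⟨v * u, hext _ _ _ ?_ ?_⟩
      · rw [map_mul, map_mul, map_mul, hv']
      · rw [map_mul, map_mul, map_mul, hu', mul_zero, mul_zero]
    obtain ⟨y, hy, z, hz, hyz⟩ := hr
    have : rs le_top b = y + z + pb f (U k).1 r := by rw [hyz]; ring
    rw [this]
    exact add_mem (add_mem (k1 y hy) (k2 z hz)) ⟨r, rfl⟩
  choose r hr using h1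
  obtain ⟨g, hg⟩ := glue (fun k => (U k).1) hU r (by
    intro k l
    apply red_inj f hs
    rw [pb_rs f _ (pre_mono f inf_le_left), pb_rs f _ (pre_mono f inf_le_right), hr, hr,
      rs_rs, rs_rs])
  have hgb : gpb f g = b := by
    refine loc_eq (fun k => f ⁻¹ᵁ (U k).1) (fun k => le_top) (fun x _ => hU (f x)) _ _ fun k => ?_
    rw [rs_gpb, hg, hr]
  subst hgb
  refine ⟨RingHom.isIntegralElem_map _, g, fun y => ⟨?_, fun h => ?_⟩⟩
  · rintro hy x rfl
    rw [basicOpen_gpb]; exact hy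
  · obtain ⟨x, rfl⟩ := hs y
    have := h x rfl
    rw [basicOpen_gpb] at this
    exact this

lemma supp_van (T : TopologicalSpace.Closeds Y) :
    (Scheme.IdealSheafData.vanishingIdeal T).support = T := by
  refine le_antisymm ?_ ?_
  · intro y hy
    obtain ⟨_, ⟨V, hV, rfl⟩, hyV, -⟩ := Y.isBasis_affineOpens.exists_subset_of_mem_open
      (Set.mem_univ y) isOpen_univ
    by_contra hyT
    obtain ⟨s, hs, hys⟩ := hV.exists_basicOpen_le (V := ⟨(T : Set Y)ᶜ, T.isClosed.isOpen_compl⟩)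
      ⟨y, hyT⟩ hyV
    rw [Scheme.IdealSheafData.mem_support_iff_of_mem (U := ⟨V, hV⟩) hyV,
      Scheme.mem_zeroLocus_iff] at hy
    exact hy s ((mem_van T ⟨V, hV⟩ s).2 fun z hz hzs => hs hzs hz) hys
  · rw [Scheme.IdealSheafData.le_support_iff_le_vanishingIdeal]

open Limits in
lemma red_case [IsReduced Y] [IsNoetherian Y] (T1 T2 : TopologicalSpace.Closeds Y)
    (h1 : T1 ≠ ⊤) (h2 : T2 ≠ ⊤) (h12 : T1 ⊔ T2 = ⊤)
    (IH : ∀ (Z : Scheme.{u}) (i : Z ⟶ Y), IsClosedImmersion i → ¬ Function.Surjective i →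
      IsAffine Z) : IsAffine Y := by
  have IH' : ∀ I : Y.IdealSheafData, I.support ≠ ⊤ → IsAffine I.subscheme := fun I hI =>
    IH _ I.subschemeι inferInstance fun h => hI (by
      apply TopologicalSpace.Closeds.ext
      rw [← Scheme.IdealSheafData.range_subschemeι, h.range_eq]; rfl)
  let I1 := Scheme.IdealSheafData.vanishingIdeal T1
  let I2 := Scheme.IdealSheafData.vanishingIdeal T2
  have a1 : IsAffine I1.subscheme := IH' I1 (by rwa [supp_van])
  have a2 : IsAffine I2.subscheme := IH' I2 (by rwa [supp_van])
  have a3 : IsAffine (I1 ⊔ I2).subscheme := IH' (I1 ⊔ I2) (by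
    rw [Scheme.IdealSheafData.support_sup, supp_van, supp_van]
    exact fun h => h1 (top_le_iff.1 (h.symm.le.trans inf_le_left)))
  have e1 : coprod.inl ≫ coprod.desc I1.subschemeι I2.subschemeι = I1.subschemeι :=
    coprod.inl_desc _ _
  have e2 : coprod.inr ≫ coprod.desc I1.subschemeι I2.subschemeι = I2.subschemeι :=
    coprod.inr_desc _ _
  have c1 : IsClosedImmersion (coprod.inl ≫ coprod.desc I1.subschemeι I2.subschemeι) := by
    rw [e1]; infer_instance
  have c2 : IsClosedImmersion (coprod.inr ≫ coprod.desc I1.subschemeι I2.subschemeι) := by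
    rw [e2]; infer_instance
  refine red_core (coprod.desc I1.subschemeι I2.subschemeι) coprod.inl coprod.inr ?_ ?_
    (I1 ⊔ I2).subschemeι ?_
  · intro V s t hs ht
    refine Scheme.OpenCover.ext_elem s t (coprodOpenCover.{u, 0} I1.subscheme I2.subscheme) ?_
    rintro (_ | _)
    · exact hs
    · exact ht
  · intro y
    have : y ∈ T1 ⊔ T2 := by rw [h12]; trivial
    rcases this with hy | hy
    · have : y ∈ Set.range I1.subschemeι := by
        rw [Scheme.IdealSheafData.range_subschemeι, supp_van]; exact hy
      obtain ⟨z, rfl⟩ := this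
      exact ⟨coprod.inl (C := Scheme.{u}) z, by rw [← Scheme.Hom.comp_apply, e1]⟩
    · have : y ∈ Set.range I2.subschemeι := by
        rw [Scheme.IdealSheafData.range_subschemeι, supp_van]; exact hy
      obtain ⟨z, rfl⟩ := this
      exact ⟨coprod.inr (C := Scheme.{u}) z, by rw [← Scheme.Hom.comp_apply, e2]⟩
  · rw [e1, e2]
    simp only [Scheme.IdealSheafData.ker_subschemeι]

end Chev

namespace Chev
variable {X Y Z W : Scheme.{u}}

lemma van_red_aux (T : TopologicalSpace.Closeds Y) (I : Y.IdealSheafData)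
    (hI : I = Scheme.IdealSheafData.vanishingIdeal T) (V : I.subscheme.Opens)
    (s : Γ(I.subscheme, V)) (n : ℕ) (hn : s ^ n = 0) : s = 0 := by
  let i := I.subschemeι
  obtain ⟨V', hV', e⟩ := i.isClosedEmbedding.isInducing.isOpen_iff.1 V.isOpen
  have hV : V = i ⁻¹ᵁ ⟨V', hV'⟩ := TopologicalSpace.Opens.ext e.symm
  subst hV
  have hcov : ∀ x ∈ i ⁻¹ᵁ ⟨V', hV'⟩, ∃ U : {U : Y.affineOpens // U.1 ≤ ⟨V', hV'⟩},
      x ∈ i ⁻¹ᵁ U.1.1 := by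
    intro x hx
    obtain ⟨_, ⟨U, hU, rfl⟩, hyU, hUV⟩ := Y.isBasis_affineOpens.exists_subset_of_mem_open
      (show i x ∈ V' from hx) hV'
    exact ⟨⟨⟨U, hU⟩, hUV⟩, hyU⟩
  refine loc_eq (fun U : {U : Y.affineOpens // U.1 ≤ ⟨V', hV'⟩} => i ⁻¹ᵁ U.1.1)
    (fun U => pre_mono i U.2) hcov s 0 fun U => ?_
  rw [map_zero]
  obtain ⟨r, hr⟩ := i.app_surjective U.1.1 U.1.2 (rs (pre_mono i U.2) s)
  have hrn : r ^ n ∈ I.ideal U.1 := by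
    rw [← I.ker_subschemeι_app, RingHom.mem_ker, map_pow]
    change (i.app U.1.1) r ^ n = 0
    rw [hr, ← map_pow, hn, map_zero]
  have hr1 : r ∈ I.ideal U.1 := by
    have h2 : r ^ (n + 1) ∈ I.ideal U.1 := by rw [pow_succ]; exact Ideal.mul_mem_right _ _ hrn
    rw [hI, mem_van] at h2 ⊢
    intro y hy hyr
    exact h2 y hy ((mem_basicOpen_pow n).2 hyr)
  rw [← hr]
  rw [← I.ker_subschemeι_app, RingHom.mem_ker] at hr1
  exact hr1

lemma van_red (T : TopologicalSpace.Closeds Y) :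
    IsReduced (Scheme.IdealSheafData.vanishingIdeal T).subscheme :=
  ⟨fun V => ⟨fun s ⟨n, hn⟩ => van_red_aux T _ rfl V s n hn⟩⟩

lemma stepS [IsReduced Y] [IsNoetherian Y] (f : X ⟶ Y) [IsFinite f] [IsAffine X]
    (hs : Function.Surjective f)
    (IH : ∀ (Z : Scheme.{u}) (i : Z ⟶ Y), IsClosedImmersion i → ¬ Function.Surjective i →
      IsAffine Z) : IsAffine Y := by
  rcases isEmpty_or_nonempty Y with hY | hY
  · infer_instance
  by_cases hirr : IsPreirreducible (Set.univ : Set Y)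
  · have : IrreducibleSpace Y := { isPreirreducible_univ := hirr, toNonempty := hY }
    have : IsIntegral Y := isIntegral_of_irreducibleSpace_of_isReduced Y
    obtain ⟨ξ, hξ⟩ := hs (genericPoint Y)
    let T : TopologicalSpace.Closeds X := ⟨closure {ξ}, isClosed_closure⟩
    let I := Scheme.IdealSheafData.vanishingIdeal T
    have hrange : Set.range I.subschemeι = closure {ξ} := by
      rw [Scheme.IdealSheafData.range_subschemeι, supp_van]; rfl
    have r1 : IsReduced I.subscheme := van_red T
    have r2 : IrreducibleSpace I.subscheme := by
      have h1 : IsIrreducible (closure {ξ} : Set X) := isIrreducible_singleton.closure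
      have hξm : ξ ∈ Set.range I.subschemeι := by
        rw [hrange]; exact subset_closure rfl
      obtain ⟨z, hz⟩ := hξm
      have hpre : IsPreirreducible (Set.univ : Set I.subscheme) := by
        have hgen : IsGenericPoint z (Set.univ : Set I.subscheme) := by
          rw [IsGenericPoint, I.subschemeι.isClosedEmbedding.isInducing.closure_eq_preimage_closure_image,
            Set.image_singleton, hz, ← hrange]
          exact Set.preimage_range _
        exact hgen.isIrreducible.isPreirreducible
      exact { isPreirreducible_univ := hpre, toNonempty := ⟨z⟩ }
    have r3 : IsIntegral I.subscheme := isIntegral_of_irreducibleSpace_of_isReduced _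
    have r4 : IsAffine I.subscheme := isAffine_of_isAffineHom I.subschemeι
    refine integral_case (I.subschemeι ≫ f) ?_ IH
    have hcl : IsClosed (Set.range (I.subschemeι ≫ f)) :=
      (I.subschemeι ≫ f).isClosedMap.isClosed_range
    have hmem : genericPoint Y ∈ Set.range (I.subschemeι ≫ f) := by
      have hξm : ξ ∈ Set.range I.subschemeι := by
        rw [hrange]; exact subset_closure rfl
      obtain ⟨z, hz⟩ := hξm
      exact ⟨z, by rw [Scheme.Hom.comp_apply, hz, hξ]⟩
    have : Set.univ ⊆ Set.range (I.subschemeι ≫ f) := by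
      rw [← (genericPoint_spec Y).def]
      exact hcl.closure_subset_iff.2 (Set.singleton_subset_iff.2 hmem)
    exact fun y => this trivial
  · rw [isPreirreducible_iff_isClosed_union_isClosed] at hirr
    push Not at hirr
    obtain ⟨T1, T2, h1, h2, h12, h3, h4⟩ := hirr
    refine red_case ⟨T1, h1⟩ ⟨T2, h2⟩ ?_ ?_ ?_ IH
    · intro h; exact h3 (congrArg (fun T : TopologicalSpace.Closeds Y => (T : Set Y)) h).ge
    · intro h; exact h4 (congrArg (fun T : TopologicalSpace.Closeds Y => (T : Set Y)) h).ge
    · apply TopologicalSpace.Closeds.ext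
      exact Set.univ_subset_iff.1 h12

open Limits in
lemma main_ind [IsNoetherian Y] (f : X ⟶ Y) [IsFinite f] [IsAffine X]
    (hs : Function.Surjective f) (T : TopologicalSpace.Closeds Y) :
    ∀ (Z : Scheme.{u}) (i : Z ⟶ Y), IsClosedImmersion i → Set.range i = T → IsAffine Z := by
  have : Surjective f := ⟨hs⟩
  induction T using WellFoundedLT.induction with
  | ind T IH =>
  intro Z i hi hiT
  have n1 : IsNoetherian Z := noeth i
  let I := Scheme.IdealSheafData.vanishingIdeal (⊤ : TopologicalSpace.Closeds Z)
  have hI : Function.Surjective I.subschemeι := by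
    rw [← Set.range_eq_univ, Scheme.IdealSheafData.range_subschemeι, supp_van]; rfl
  have r1 : IsReduced I.subscheme := van_red ⊤
  have n2 : IsNoetherian I.subscheme := noeth I.subschemeι
  suffices IsAffine I.subscheme from nil_affine I.subschemeι hI
  have c : IsClosedImmersion (pullback.fst f (I.subschemeι ≫ i)) := inferInstance
  have a : IsAffine (pullback f (I.subschemeι ≫ i)) :=
    isAffine_of_isAffineHom (pullback.fst f (I.subschemeι ≫ i))
  refine stepS (pullback.snd f (I.subschemeι ≫ i)) (pullback.snd f (I.subschemeι ≫ i)).surjective ?_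
  intro Z' i' hi' hns
  have c2 : IsClosedImmersion (i' ≫ I.subschemeι ≫ i) := inferInstance
  refine IH ⟨Set.range (i' ≫ I.subschemeι ≫ i), c2.isClosedEmbedding.isClosed_range⟩ ?_ Z'
    (i' ≫ I.subschemeι ≫ i) c2 rfl
  rw [lt_iff_le_and_ne]
  constructor
  · rintro _ ⟨z, rfl⟩
    change _ ∈ (T : Set Y)
    rw [← hiT]
    exact ⟨I.subschemeι (i' z), by simp⟩
  · intro h
    apply hns
    intro z
    have hz : i (I.subschemeι z) ∈ (T : Set Y) := by rw [← hiT]; exact ⟨_, rfl⟩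
    rw [← h] at hz
    obtain ⟨w, hw⟩ := hz
    refine ⟨w, (I.subschemeι ≫ i).isClosedEmbedding.injective ?_⟩
    simpa using hw

end Chev

/-- **Chevalley's theorem on affineness.** Let `f : X ⟶ Y` be a finite surjective
morphism of (Noetherian, separated) schemes over `ℂ` with `X` affine. Then `Y` is affine. -/
theorem isAffine_of_finite_surjective
    (X Y : Scheme) [IsAffine X] [IsNoetherian X] [IsNoetherian Y]
    (sX : X ⟶ Spec (CommRingCat.of ℂ)) (sY : Y ⟶ Spec (CommRingCat.of ℂ))
    [IsSeparated sX] [IsSeparated sY]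
    (f : X ⟶ Y) (hcf : f ≫ sY = sX) [IsFinite f]
    (hsurj : Function.Surjective f.base) :
    IsAffine Y := by
  have h : Function.Surjective f := hsurj
  refine Chev.main_ind f h ⊤ Y (𝟙 Y) inferInstance ?_
  exact Set.range_eq_univ.2 fun y => ⟨y, rfl⟩
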